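/- (Key lemma, strict version) Let M = (Q, E, δ) be an MDP with priority function p : Q → ℕ and weight function w : Q × Q → ℤ such that the whole state space Q is an end-component of M and the minimum of p over Q is even. If there exists a state q ∈ Q with ValMP(w)(q) > ν for a threshold ν ∈ ℝ, then there exists a strategy σ* such that for every state q ∈ Q, P_q^{σ*}(Parity(p) ∩ MeanPayoff^{>ν}) = 1. -/

import Mathlib

open MeasureTheory Filter
open scoped Classical ENNReal

namespace MPP

/-- A Markov decision process: states `Q`, player-1 states `Q1` (the rest are
probabilistic), edge relation `E` with every state having a successor, and a
probabilistic transition function `δ` whose support at every probabilistic state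
is exactly the set of successors. -/
structure MDP (Q : Type) where
  Q1 : Set Q
  E : Q → Q → Prop
  E_nonempty : ∀ q, ∃ q', E q q'
  δ : Q → PMF Q
  δ_support : ∀ q, q ∉ Q1 → ∀ q', q' ∈ (δ q).support ↔ E q q'

/-- A strategy: given the history `h` (the states strictly before the current one)
and the current state `q`, if `q` is a player-1 state it selects a distribution on
successors of `q`. -/
structure Strategy {Q : Type} (M : MDP Q) where
  act : List Q → Q → PMF Q
  act_support : ∀ h q, q ∈ M.Q1 → ∀ q', q' ∈ (act h q).support → M.E q q'

variable {Q : Type}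

/-- One step of the history-dependent transition kernel. -/
noncomputable def MDP.step (M : MDP Q) (σ : Strategy M) (h : List Q) (q : Q) : PMF Q :=
  if q ∈ M.Q1 then σ.act h q else M.δ q

/-- Probability of traversing the finite sequence `future` starting at `q` with
past history `h`. -/
noncomputable def pathProb (M : MDP Q) (σ : Strategy M) : List Q → Q → List Q → ℝ≥0∞
  | _, _, [] => 1
  | h, q, q' :: rest => M.step σ h q q' * pathProb M σ (h ++ [q]) q' rest

/-- `μ` is the trajectory measure (Ionescu–Tulcea) on plays of `M` under strategy
`σ`, starting at `q`: it is the (unique) probability measure on `ℕ → Q` (product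
σ-algebra) giving every cylinder its product probability. -/
def IsTrajMeasure [MeasurableSpace Q] (M : MDP Q) (σ : Strategy M) (q : Q)
    (μ : Measure (ℕ → Q)) : Prop :=
  IsProbabilityMeasure μ ∧
    ∀ (n : ℕ) (f : ℕ → Q),
      μ {ρ | ∀ i ≤ n, ρ i = f i} =
        if f 0 = q then pathProb M σ [] q ((List.range n).map fun i => f (i + 1)) else 0

/-- The set of states occurring infinitely often in a play. -/
def infSet (ρ : ℕ → Q) : Set Q := {s | ∀ N, ∃ n, N ≤ n ∧ ρ n = s}

/-- End-component: nonempty, closed under probabilistic transitions, every state has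
a successor inside, and strongly connected inside. -/
def MDP.IsEndComponent (M : MDP Q) (U : Set Q) : Prop :=
  U.Nonempty ∧
    (∀ q ∈ U, q ∉ M.Q1 → (M.δ q).support ⊆ U) ∧
    (∀ q ∈ U, ∃ q' ∈ U, M.E q q') ∧
    ∀ q ∈ U, ∀ q' ∈ U, Relation.ReflTransGen (fun a b => a ∈ U ∧ b ∈ U ∧ M.E a b) q q'

/-- Energy level of the length-`n` prefix of a play. -/
def EL (w : Q → Q → ℤ) (ρ : ℕ → Q) (n : ℕ) : ℤ :=
  ∑ i ∈ Finset.range n, w (ρ i) (ρ (i + 1))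

/-- Mean payoff (liminf of averages) of a play. -/
noncomputable def MP (w : Q → Q → ℤ) (ρ : ℕ → Q) : ℝ :=
  liminf (fun n => (EL w ρ n : ℝ) / n) atTop

/-- Parity objective: the minimal priority visited infinitely often is even. -/
def ParitySet (p : Q → ℕ) : Set (ℕ → Q) := {ρ | Even (sInf (p '' infSet ρ))}

def MeanPayoffGe (w : Q → Q → ℤ) (ν : ℝ) : Set (ℕ → Q) := {ρ | ν ≤ MP w ρ}

def MeanPayoffGt (w : Q → Q → ℤ) (ν : ℝ) : Set (ℕ → Q) := {ρ | ν < MP w ρ}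

/-- Energy objective with initial credit `c₀`. -/
def PosEnergy (w : Q → Q → ℤ) (c₀ : ℕ) : Set (ℕ → Q) :=
  {ρ | ∀ n, 0 ≤ (c₀ : ℤ) + EL w ρ n}

/-- Büchi objective: some state of `B` is visited infinitely often. -/
def Buchi (B : Set Q) : Set (ℕ → Q) := {ρ | (infSet ρ ∩ B).Nonempty}

/-- Expected mean-payoff value: supremum over strategies of the expectation of the
mean payoff under the trajectory measure. -/
noncomputable def ValMP [MeasurableSpace Q] (M : MDP Q) (w : Q → Q → ℤ) (q : Q) : ℝ :=
  sSup {x | ∃ σ : Strategy M, ∃ μ : Measure (ℕ → Q),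
    IsTrajMeasure M σ q μ ∧ x = ∫ ρ, MP w ρ ∂μ}



/-! ### Cylinders and existence of the trajectory measure -/

/-- The history strictly before time `n`. -/
def hist (ρ : ℕ → Q) (n : ℕ) : List Q := (List.range n).map ρ

lemma hist_congr {ρ ρ' : ℕ → Q} {n : ℕ} (h : ∀ i < n, ρ i = ρ' i) : hist ρ n = hist ρ' n := by
  unfold hist
  apply List.map_congr_left
  intro i hi
  exact h i (List.mem_range.1 hi)

lemma range_map_succ {α : Type} (g : ℕ → α) (n : ℕ) :
    (List.range (n + 1)).map g = g 0 :: (List.range n).map (fun i => g (i + 1)) := by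
  rw [List.range_succ_eq_map, List.map_cons, List.map_map]
  rfl

lemma pathProb_succ (M : MDP Q) (σ : Strategy M) (n : ℕ) : ∀ (h : List Q) (f : ℕ → Q),
    pathProb M σ h (f 0) ((List.range (n + 1)).map fun i => f (i + 1)) =
      pathProb M σ h (f 0) ((List.range n).map fun i => f (i + 1)) *
        M.step σ (h ++ hist f n) (f n) (f (n + 1)) := by
  induction n with
  | zero => intro h f; simp [pathProb, hist]
  | succ n ih =>
    intro h f
    have := ih (h ++ [f 0]) (fun i => f (i + 1))
    rw [range_map_succ (fun i => f (i + 1)) (n + 1), range_map_succ (fun i => f (i + 1)) n,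
      pathProb, pathProb, this]
    have e2 : hist f (n + 1) = f 0 :: hist (fun i => f (i + 1)) n := range_map_succ f n
    rw [e2]
    simp [mul_assoc]

lemma cyl_succ [MeasurableSpace Q] {M : MDP Q} {σ : Strategy M} {q : Q} {μ : Measure (ℕ → Q)}
    (hμ : IsTrajMeasure M σ q μ) (n : ℕ) (f : ℕ → Q) :
    μ {ρ | ∀ i ≤ n + 1, ρ i = f i} =
      μ {ρ | ∀ i ≤ n, ρ i = f i} * M.step σ (hist f n) (f n) (f (n + 1)) := by
  rw [hμ.2, hμ.2]
  split_ifs with h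
  · subst h
    simpa using pathProb_succ M σ n [] f
  · simp

section exist
variable [Fintype Q] [MeasurableSpace Q] [MeasurableSingletonClass Q]

/-- Extend a finite prefix to a play. -/
def yext (n : ℕ) (y : (i : Finset.Iic n) → (fun _ : ℕ => Q) i) : ℕ → Q :=
  fun i => y ⟨min i n, by simp⟩

/-- Restrict a play to a finite prefix. -/
def restr (n : ℕ) (f : ℕ → Q) : (i : Finset.Iic n) → (fun _ : ℕ => Q) i := fun i => f i

/-- The coordinate at time `n + 1`. -/
def restr' (n : ℕ) (f : ℕ → Q) : (i : Finset.Ioc n (n + 1)) → (fun _ : ℕ => Q) i := fun i => f i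

/-- The transition kernels. -/
noncomputable def stepKer (M : MDP Q) (σ : Strategy M) (n : ℕ) :
    ProbabilityTheory.Kernel ((i : Finset.Iic n) → (fun _ : ℕ => Q) i) ((fun _ : ℕ => Q) (n + 1)) :=
  ProbabilityTheory.Kernel.ofFunOfCountable
    (fun y => (M.step σ (hist (yext n y) n) (yext n y n)).toMeasure)

instance (M : MDP Q) (σ : Strategy M) (n : ℕ) :
    ProbabilityTheory.IsMarkovKernel (stepKer M σ n) :=
  ⟨fun y => by unfold stepKer; exact PMF.toMeasure.isProbabilityMeasure _⟩

lemma partialTraj_singleton (M : MDP Q) (σ : Strategy M) (q : Q) (f : ℕ → Q) (n : ℕ) :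
    ProbabilityTheory.Kernel.partialTraj (X := fun _ => Q) (stepKer M σ) 0 n (fun _ => q)
      {restr n f} =
        if f 0 = q then pathProb M σ [] q ((List.range n).map fun i => f (i + 1)) else 0 := by
  induction n with
  | zero =>
    rw [ProbabilityTheory.Kernel.partialTraj_self, ProbabilityTheory.Kernel.id_apply,
      Measure.dirac_apply' _ (MeasurableSet.singleton _)]
    simp only [List.range_zero, List.map_nil, pathProb, Set.indicator_apply, Set.mem_singleton_iff]
    congr 1
    apply propext
    constructor
    · intro h
      exact (congrFun h ⟨0, by simp⟩).symm
    · rintro h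
      funext ⟨i, hi⟩
      have : i = 0 := by simpa using hi
      subst this
      exact h.symm
  | succ n ih =>
    rw [ProbabilityTheory.Kernel.partialTraj_succ_of_le (Nat.zero_le n),
      ProbabilityTheory.Kernel.map_apply' _ (by fun_prop) _ (MeasurableSet.singleton _),
      ProbabilityTheory.Kernel.comp_apply' _ _ _
        (measurable_IicProdIoc (X := fun _ : ℕ => Q) (MeasurableSet.singleton (restr (n + 1) f)))]
    have key : ∀ b : (i : Finset.Iic n) → (fun _ : ℕ => Q) i,
      ((ProbabilityTheory.Kernel.id.prod ((stepKer M σ n).map (MeasurableEquiv.piSingleton (X := fun _ : ℕ => Q) n))) b)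
        (IicProdIoc (X := fun _ : ℕ => Q) n (n + 1) ⁻¹' {restr (n + 1) f}) =
      Set.indicator {restr n f} (fun _ => M.step σ (hist f n) (f n) (f (n + 1))) b := by
      intro b
      have e : (IicProdIoc (X := fun _ : ℕ => Q) n (n + 1) ⁻¹' {restr (n + 1) f} :
          Set (((i : Finset.Iic n) → (fun _ : ℕ => Q) i) ×
            ((i : Finset.Ioc n (n + 1)) → (fun _ : ℕ => Q) i))) =
          {restr n f} ×ˢ {restr' n f} := by
        ext ⟨u, v⟩
        simp only [Set.mem_preimage, Set.mem_singleton_iff, Set.mem_prod]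
        constructor
        · intro h
          constructor
          · funext ⟨i, hi⟩
            have hi' : i ≤ n := by simpa using hi
            have := congrFun h ⟨i, by simp; omega⟩
            simpa [IicProdIoc, hi', restr, restr'] using this
          · funext ⟨i, hi⟩
            have hi' : i = n + 1 := by simpa using hi
            have := congrFun h ⟨i, by simp; omega⟩
            simpa [IicProdIoc, hi', restr, restr'] using this
        · rintro ⟨rfl, rfl⟩
          funext ⟨i, hi⟩
          simp [IicProdIoc, restr, restr']
      rw [e, ProbabilityTheory.Kernel.prod_apply, Measure.prod_prod,
        ProbabilityTheory.Kernel.id_apply, Measure.dirac_apply' _ (MeasurableSet.singleton _),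
        ProbabilityTheory.Kernel.map_apply' _ (MeasurableEquiv.measurable _) _
          (MeasurableSet.singleton _)]
      by_cases hb : b = restr n f
      · subst hb
        have e1 : (MeasurableEquiv.piSingleton (X := fun _ : ℕ => Q) n) ⁻¹' {restr' n f} =
            {f (n + 1)} := by
          ext x
          simp only [Set.mem_preimage, Set.mem_singleton_iff]
          constructor
          · intro h
            exact congrFun h ⟨n + 1, by simp⟩
          · rintro rfl
            funext ⟨i, hi⟩
            have hi' : i = n + 1 := by simpa using hi
            subst hi'
            rfl
        rw [e1]
        have e2 : hist (yext n (restr n f)) n = hist f n := by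
          apply hist_congr
          intro i hi
          simp [yext, restr, hi.le]
        have e3 : yext n (restr n f) n = f n := by simp [yext, restr]
        have : stepKer M σ n (restr n f) {f (n + 1)} =
          M.step σ (hist f n) (f n) (f (n + 1)) := by
          change (M.step σ (hist (yext n (restr n f)) n) (yext n (restr n f) n)).toMeasure
            {f (n + 1)} = _
          rw [e2, e3, PMF.toMeasure_apply_singleton _ _ (MeasurableSet.singleton _)]
        rw [this]
        simp
      · simp [hb]
    simp_rw [key]
    rw [lintegral_indicator_const (MeasurableSet.singleton _), ih]
    split_ifs with h
    · subst h
      rw [mul_comm]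
      simpa using (pathProb_succ M σ n [] f).symm
    · simp

lemma exists_traj (M : MDP Q) (σ : Strategy M) (q : Q) :
    ∃ μ : Measure (ℕ → Q), IsTrajMeasure M σ q μ := by
  refine ⟨ProbabilityTheory.Kernel.traj (X := fun _ => Q) (stepKer M σ) 0 (fun _ => q),
    inferInstance, fun n f => ?_⟩
  rw [← partialTraj_singleton, ← ProbabilityTheory.Kernel.traj_map_frestrictLe_apply,
    Measure.map_apply (by fun_prop) (MeasurableSet.singleton _)]
  congr 1
  ext ρ
  simp only [Set.mem_ofPred_eq, Set.mem_preimage, Set.mem_singleton_iff, funext_iff]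
  constructor
  · rintro h ⟨i, hi⟩
    exact h i (by simpa using hi)
  · intro h i hi
    exact h ⟨i, by simpa using hi⟩

end exist

/-- Extend a finite sequence to a play. -/
def fext (n : ℕ) (a : Fin (n + 1) → Q) : ℕ → Q := fun i => a ⟨min i n, by omega⟩

lemma fext_snoc_le {n : ℕ} (x : Q) (a : Fin (n + 1) → Q) {i : ℕ} (hi : i ≤ n) :
    fext (n + 1) (Fin.snocEquiv (fun _ => Q) (x, a)) i = fext n a i := by
  have h : min i (n + 1) < n + 1 := by omega
  simp only [fext, Fin.snocEquiv, Equiv.coe_fn_mk, Fin.snoc, h, dite_true]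
  simp only [Fin.castLT, cast_eq]
  congr 2
  omega

lemma fext_snoc_succ {n : ℕ} (x : Q) (a : Fin (n + 1) → Q) :
    fext (n + 1) (Fin.snocEquiv (fun _ => Q) (x, a)) (n + 1) = x := by
  simp [fext, Fin.snocEquiv, Fin.snoc]

lemma pmf_sum_toReal [Fintype Q] (P : PMF Q) : ∑ x, (P x).toReal = 1 := by
  rw [← ENNReal.toReal_sum (fun x _ => P.apply_ne_top x)]
  have := P.tsum_coe
  rw [tsum_fintype] at this
  simp [this]

section prob
variable [Fintype Q] [MeasurableSpace Q] [MeasurableSingletonClass Q]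

/-! ### Integration of functions of finitely many coordinates -/

lemma measurable_pair {β : Type} [MeasurableSpace β] (φ : Q → Q → β) (i j : ℕ) :
    Measurable (fun ρ : ℕ → Q => φ (ρ i) (ρ j)) := by
  have h1 : Measurable (fun z : Q × Q => φ z.1 z.2) := Measurable.of_discrete
  have h2 : Measurable (fun ρ : ℕ → Q => (ρ i, ρ j)) :=
    (measurable_pi_apply i).prodMk (measurable_pi_apply j)
  exact h1.comp h2

lemma lintegral_dep (μ : Measure (ℕ → Q)) (n : ℕ) (G : (ℕ → Q) → ℝ≥0∞)
    (hG : ∀ ρ ρ' : ℕ → Q, (∀ i ≤ n, ρ i = ρ' i) → G ρ = G ρ') :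
    ∫⁻ ρ, G ρ ∂μ = ∑ a : Fin (n + 1) → Q, G (fext n a) * μ {ρ | ∀ i ≤ n, ρ i = fext n a i} := by
  have hm : Measurable (fun (ρ : ℕ → Q) (i : Fin (n + 1)) => ρ i) :=
    measurable_pi_lambda _ (fun i => measurable_pi_apply _)
  have e : ∀ ρ, G ρ = (fun a => G (fext n a)) (fun i : Fin (n + 1) => ρ i) := by
    intro ρ
    apply hG
    intro i hi
    simp [fext, hi]
  rw [lintegral_congr e, ← lintegral_map (f := fun a : Fin (n + 1) → Q => G (fext n a)) (Measurable.of_discrete) hm, lintegral_fintype]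
  apply Finset.sum_congr rfl
  intro a _
  rw [Measure.map_apply hm (MeasurableSet.singleton _)]
  congr 2
  ext ρ
  simp only [Set.mem_preimage, Set.mem_singleton_iff, Set.mem_ofPred_eq, funext_iff]
  constructor
  · intro h i hi
    have := h ⟨i, by omega⟩
    simpa [fext, hi] using this
  · rintro h ⟨i, hi⟩
    have hi' : i ≤ n := by omega
    have := h i hi'
    simpa [fext, hi'] using this

lemma lintegral_step {M : MDP Q} {σ : Strategy M} {q : Q} {μ : Measure (ℕ → Q)}
    (hμ : IsTrajMeasure M σ q μ) (n : ℕ) (G : (ℕ → Q) → ℝ≥0∞)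
    (hG : ∀ ρ ρ' : ℕ → Q, (∀ i ≤ n, ρ i = ρ' i) → G ρ = G ρ')
    (φ : Q → Q → ℝ≥0∞) (r : ℝ≥0∞)
    (hr : ∀ h q, ∑ x, M.step σ h q x * φ q x ≤ r) :
    ∫⁻ ρ, G ρ * φ (ρ n) (ρ (n + 1)) ∂μ ≤ r * ∫⁻ ρ, G ρ ∂μ := by
  rw [lintegral_dep μ n G hG, lintegral_dep μ (n + 1) (fun ρ => G ρ * φ (ρ n) (ρ (n + 1)))]
  swap
  · intro ρ ρ' h
    rw [hG ρ ρ' (fun i hi => h i (by omega)), h n (by omega), h (n + 1) le_rfl]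
  rw [← (Fin.snocEquiv (fun _ => Q)).sum_comp, Fintype.sum_prod_type_right, Finset.mul_sum]
  apply Finset.sum_le_sum
  intro a _
  have key : ∀ x : Q, G (fext (n + 1) (Fin.snocEquiv (fun _ => Q) (x, a))) *
        φ (fext (n + 1) (Fin.snocEquiv (fun _ => Q) (x, a)) n)
          (fext (n + 1) (Fin.snocEquiv (fun _ => Q) (x, a)) (n + 1)) *
        μ {ρ | ∀ i ≤ n + 1, ρ i = fext (n + 1) (Fin.snocEquiv (fun _ => Q) (x, a)) i} =
      (G (fext n a) * μ {ρ | ∀ i ≤ n, ρ i = fext n a i}) *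
        (M.step σ (hist (fext n a) n) (fext n a n) x * φ (fext n a n) x) := by
    intro x
    rw [cyl_succ hμ, hG _ (fext n a) (fun i hi => fext_snoc_le x a hi),
      fext_snoc_le x a le_rfl, fext_snoc_succ,
      hist_congr (fun i (hi : i < n) => fext_snoc_le x a hi.le)]
    have : {ρ : ℕ → Q | ∀ i ≤ n, ρ i = fext (n + 1) (Fin.snocEquiv (fun _ => Q) (x, a)) i} =
        {ρ | ∀ i ≤ n, ρ i = fext n a i} := by
      ext ρ
      simp only [Set.mem_ofPred_eq]
      exact forall₂_congr (fun i hi => by rw [fext_snoc_le x a hi])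
    rw [this]
    ring
  rw [Finset.sum_congr rfl (fun x _ => key x), ← Finset.mul_sum, mul_comm r]
  gcongr
  exact hr _ _

lemma lintegral_prod_le {M : MDP Q} {σ : Strategy M} {q : Q} {μ : Measure (ℕ → Q)}
    (hμ : IsTrajMeasure M σ q μ) (φ : Q → Q → ℝ≥0∞) (r : ℝ≥0∞)
    (hr : ∀ h q, ∑ x, M.step σ h q x * φ q x ≤ r) (n : ℕ) :
    ∫⁻ ρ, ∏ i ∈ Finset.range n, φ (ρ i) (ρ (i + 1)) ∂μ ≤ r ^ n := by
  induction n with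
  | zero =>
    have := hμ.1
    simp
  | succ n ih =>
    simp_rw [Finset.prod_range_succ]
    refine (lintegral_step hμ n _ ?_ φ r hr).trans ?_
    · intro ρ ρ' h
      apply Finset.prod_congr rfl
      intro i hi
      have := Finset.mem_range.1 hi
      rw [h i (by omega), h (i + 1) (by omega)]
    · rw [pow_succ']
      gcongr

/-- Exponential Borel–Cantelli: uniformly positive conditional drift implies that the partial
sums are eventually positive, almost surely. -/
lemma eventually_pos {M : MDP Q} {σ : Strategy M} {q : Q} {μ : Measure (ℕ → Q)}
    (hμ : IsTrajMeasure M σ q μ) (Z : Q → Q → ℝ) (η : ℝ) (hη : 0 < η)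
    (hZ : ∀ h q, η ≤ ∑ x, (M.step σ h q x).toReal * Z q x) :
    ∀ᵐ ρ ∂μ, ∀ᶠ n in atTop, 0 < ∑ i ∈ Finset.range n, Z (ρ i) (ρ (i + 1)) := by
  obtain ⟨B, hB⟩ : ∃ B : ℝ, ∀ a b, |Z a b| ≤ B := by
    refine ⟨∑ a, ∑ b, |Z a b|, fun a b => ?_⟩
    calc |Z a b| ≤ ∑ b, |Z a b| :=
          Finset.single_le_sum (f := fun b => |Z a b|) (fun _ _ => abs_nonneg _) (Finset.mem_univ b)
      _ ≤ _ := Finset.single_le_sum (f := fun a => ∑ b, |Z a b|)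
          (fun _ _ => Finset.sum_nonneg (fun _ _ => abs_nonneg _)) (Finset.mem_univ a)
  have hηB : η ≤ B := by
    refine (hZ [] q).trans ?_
    calc ∑ x, (M.step σ [] q x).toReal * Z q x ≤ ∑ x, (M.step σ [] q x).toReal * B :=
          Finset.sum_le_sum (fun x _ => mul_le_mul_of_nonneg_left
            ((le_abs_self _).trans (hB q x)) ENNReal.toReal_nonneg)
      _ = B := by rw [← Finset.sum_mul, pmf_sum_toReal, one_mul]
  have hBpos : 0 < B := hη.trans_le hηB
  set t : ℝ := η / (2 * B ^ 2) with ht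
  have htpos : 0 < t := by positivity
  have htB : t * B ≤ 1 := by
    rw [ht, div_mul_eq_mul_div, div_le_one (by positivity)]
    nlinarith
  have h2 : t * (2 * B ^ 2) = η := by rw [ht]; field_simp
  set r : ℝ := 1 - t * η + t ^ 2 * B ^ 2 with hrdef
  have hr1 : r < 1 := by
    rw [hrdef, ← h2]
    nlinarith [mul_pos (mul_pos htpos htpos) (mul_pos hBpos hBpos)]
  have hr : ∀ h q, ∑ x, M.step σ h q x * ENNReal.ofReal (Real.exp (-t * Z q x)) ≤
      ENNReal.ofReal r := by
    intro h q
    have e : ∀ x, M.step σ h q x * ENNReal.ofReal (Real.exp (-t * Z q x)) =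
        ENNReal.ofReal ((M.step σ h q x).toReal * Real.exp (-t * Z q x)) := by
      intro x
      rw [ENNReal.ofReal_mul ENNReal.toReal_nonneg, ENNReal.ofReal_toReal (PMF.apply_ne_top _ _)]
    rw [Finset.sum_congr rfl (fun x _ => e x), ← ENNReal.ofReal_sum_of_nonneg
      (fun x _ => mul_nonneg ENNReal.toReal_nonneg (Real.exp_pos _).le)]
    apply ENNReal.ofReal_le_ofReal
    calc ∑ x, (M.step σ h q x).toReal * Real.exp (-t * Z q x)
        ≤ ∑ x, (M.step σ h q x).toReal * (1 + t ^ 2 * B ^ 2 - t * Z q x) := by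
          apply Finset.sum_le_sum
          intro x _
          apply mul_le_mul_of_nonneg_left _ ENNReal.toReal_nonneg
          have hz := hB q x
          have habs : |-t * Z q x| ≤ 1 := by
            rw [abs_mul, abs_neg, abs_of_pos htpos]
            exact (mul_le_mul_of_nonneg_left hz htpos.le).trans htB
          have := (abs_le.1 (Real.abs_exp_sub_one_sub_id_le habs)).2
          have hsq : (Z q x) ^ 2 ≤ B ^ 2 := by
            rw [← sq_abs]
            gcongr
          have : (-t * Z q x) ^ 2 ≤ t ^ 2 * B ^ 2 := by
            rw [mul_pow, neg_sq]
            gcongr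
          linarith
      _ = (1 + t ^ 2 * B ^ 2) - t * ∑ x, (M.step σ h q x).toReal * Z q x := by
          simp_rw [mul_sub]
          rw [Finset.sum_sub_distrib, ← Finset.sum_mul, pmf_sum_toReal, Finset.mul_sum, one_mul]
          congr 1
          apply Finset.sum_congr rfl
          intro x _
          ring
      _ ≤ r := by
          have := mul_le_mul_of_nonneg_left (hZ h q) htpos.le
          linarith
  have hI := lintegral_prod_le hμ (fun a b => ENNReal.ofReal (Real.exp (-t * Z a b)))
    (ENNReal.ofReal r) hr
  have hmeas : ∀ n, Measurable (fun ρ : ℕ → Q =>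
      ∏ i ∈ Finset.range n, ENNReal.ofReal (Real.exp (-t * Z (ρ i) (ρ (i + 1))))) := by
    intro n
    apply Finset.measurable_fun_prod
    intro i _
    exact measurable_pair (fun a b => ENNReal.ofReal (Real.exp (-t * Z a b))) i (i + 1)
  have hs : ∀ n, μ {ρ | ∑ i ∈ Finset.range n, Z (ρ i) (ρ (i + 1)) ≤ 0} ≤ ENNReal.ofReal r ^ n := by
    intro n
    refine le_trans ?_ (hI n)
    refine le_trans (measure_mono ?_) (by
      simpa using mul_meas_ge_le_lintegral (μ := μ) (hmeas n) 1)
    intro ρ hρ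
    simp only [Set.mem_ofPred_eq] at hρ ⊢
    rw [← ENNReal.ofReal_prod_of_nonneg (fun i _ => (Real.exp_pos _).le), ← Real.exp_sum,
      ← ENNReal.ofReal_one]
    rw [Finset.sum_neg_distrib, ← Finset.mul_sum]
    apply ENNReal.ofReal_le_ofReal
    rw [Real.one_le_exp_iff]
    nlinarith
  have hsum : ∑' n, μ {ρ | ∑ i ∈ Finset.range n, Z (ρ i) (ρ (i + 1)) ≤ 0} ≠ ∞ := by
    refine ne_top_of_le_ne_top ?_ (ENNReal.tsum_le_tsum hs)
    rw [ENNReal.tsum_geometric]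
    apply ENNReal.inv_ne_top.2
    apply (tsub_pos_of_lt _).ne'
    rw [← ENNReal.ofReal_one]
    exact (ENNReal.ofReal_lt_ofReal_iff one_pos).2 hr1
  filter_upwards [ae_eventually_notMem hsum] with ρ hρ
  filter_upwards [hρ] with n hn
  simpa using hn

end prob

/-! ### Deterministic lemmas on the mean payoff -/

lemma EL_div_bound {w : Q → Q → ℤ} {W : ℝ} (hW : ∀ a b, |(w a b : ℝ)| ≤ W) (ρ : ℕ → Q) (n : ℕ) :
    |(EL w ρ n : ℝ) / n| ≤ W := by
  have hW0 : 0 ≤ W := (abs_nonneg _).trans (hW (ρ 0) (ρ 0))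
  rcases Nat.eq_zero_or_pos n with rfl | hn
  · simpa using hW0
  have hn' : (0 : ℝ) < n := by exact_mod_cast hn
  rw [abs_div, Nat.abs_cast, div_le_iff₀ hn']
  unfold EL
  push_cast
  refine (Finset.abs_sum_le_sum_abs _ _).trans ?_
  refine (Finset.sum_le_sum (fun i _ => hW (ρ i) (ρ (i + 1)))).trans ?_
  simp [mul_comm]

lemma EL_bdd_ge {w : Q → Q → ℤ} {W : ℝ} (hW : ∀ a b, |(w a b : ℝ)| ≤ W) (ρ : ℕ → Q) :
    IsBoundedUnder (· ≥ ·) atTop (fun n => (EL w ρ n : ℝ) / n) :=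
  isBoundedUnder_of ⟨-W, fun n => (abs_le.1 (EL_div_bound hW ρ n)).1⟩

lemma EL_bdd_le {w : Q → Q → ℤ} {W : ℝ} (hW : ∀ a b, |(w a b : ℝ)| ≤ W) (ρ : ℕ → Q) :
    IsBoundedUnder (· ≤ ·) atTop (fun n => (EL w ρ n : ℝ) / n) :=
  isBoundedUnder_of ⟨W, fun n => (abs_le.1 (EL_div_bound hW ρ n)).2⟩

lemma tendsto_aux (c K : ℝ) : Tendsto (fun n : ℕ => c + K / n) atTop (nhds c) := by
  simpa using (tendsto_const_nhds (x := c)).add (tendsto_const_div_atTop_nhds_zero_nat K)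

lemma MP_le {w : Q → Q → ℤ} {W : ℝ} (hW : ∀ a b, |(w a b : ℝ)| ≤ W) (ρ : ℕ → Q) (c K : ℝ)
    (h : ∀ᶠ n : ℕ in atTop, (EL w ρ n : ℝ) ≤ n * c + K) : MP w ρ ≤ c := by
  have ht := tendsto_aux c K
  rw [← ht.liminf_eq]
  refine liminf_le_liminf ?_ (EL_bdd_ge hW ρ) ht.isBoundedUnder_le.isCoboundedUnder_ge
  filter_upwards [h, eventually_gt_atTop 0] with n hn hn0
  have hn' : (0 : ℝ) < n := by exact_mod_cast hn0
  rw [div_le_iff₀ hn']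
  have : (c + K / n) * n = n * c + K := by field_simp
  linarith

lemma le_MP {w : Q → Q → ℤ} {W : ℝ} (hW : ∀ a b, |(w a b : ℝ)| ≤ W) (ρ : ℕ → Q) (c K : ℝ)
    (h : ∀ᶠ n : ℕ in atTop, n * c + K ≤ (EL w ρ n : ℝ)) : c ≤ MP w ρ := by
  have ht := tendsto_aux c K
  rw [← ht.liminf_eq]
  refine liminf_le_liminf ?_ ht.isBoundedUnder_ge (EL_bdd_le hW ρ).isCoboundedUnder_ge
  filter_upwards [h, eventually_gt_atTop 0] with n hn hn0
  have hn' : (0 : ℝ) < n := by exact_mod_cast hn0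
  rw [le_div_iff₀ hn']
  have : (c + K / n) * n = n * c + K := by field_simp
  linarith

lemma MP_bound {w : Q → Q → ℤ} {W : ℝ} (hW : ∀ a b, |(w a b : ℝ)| ≤ W) (ρ : ℕ → Q) :
    |MP w ρ| ≤ W := by
  have h : ∀ n : ℕ, |(EL w ρ n : ℝ)| ≤ n * W := by
    intro n
    rcases Nat.eq_zero_or_pos n with rfl | hn
    · simp [EL]
    have hn' : (0 : ℝ) < n := by exact_mod_cast hn
    have := EL_div_bound hW ρ n
    rwa [abs_div, Nat.abs_cast, div_le_iff₀ hn', mul_comm] at this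
  rw [abs_le]
  constructor
  · exact le_MP hW ρ (-W) 0 (Eventually.of_forall fun n => by
      have := (abs_le.1 (h n)).1
      linarith)
  · exact MP_le hW ρ W 0 (Eventually.of_forall fun n => by
      have := (abs_le.1 (h n)).2
      linarith)

lemma sum_tele (w : Q → Q → ℤ) (H : Q → ℝ) (c : ℝ) (ρ : ℕ → Q) (n : ℕ) :
    ∑ i ∈ Finset.range n, ((w (ρ i) (ρ (i + 1)) : ℝ) + H (ρ (i + 1)) - H (ρ i) - c) =
      EL w ρ n + H (ρ n) - H (ρ 0) - n * c := by
  induction n with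
  | zero => simp [EL]
  | succ n ih =>
    rw [Finset.sum_range_succ, ih]
    unfold EL
    rw [Finset.sum_range_succ]
    push_cast
    ring

lemma exists_abs_bound [Fintype Q] (F : Q → Q → ℝ) : ∃ B : ℝ, 0 ≤ B ∧ ∀ a b, |F a b| ≤ B := by
  refine ⟨∑ a, ∑ b, |F a b|, by positivity, fun a b => ?_⟩
  calc |F a b| ≤ ∑ b, |F a b| :=
        Finset.single_le_sum (f := fun b => |F a b|) (fun _ _ => abs_nonneg _) (Finset.mem_univ b)
    _ ≤ _ := Finset.single_le_sum (f := fun a => ∑ b, |F a b|)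
        (fun _ _ => Finset.sum_nonneg (fun _ _ => abs_nonneg _)) (Finset.mem_univ a)

lemma exists_abs_bound1 [Fintype Q] (H : Q → ℝ) : ∃ B : ℝ, 0 ≤ B ∧ ∀ a, |H a| ≤ B :=
  ⟨∑ a, |H a|, by positivity, fun a =>
    Finset.single_le_sum (f := fun b => |H b|) (fun _ _ => abs_nonneg _) (Finset.mem_univ a)⟩

/-! ### Lyapunov functions -/

/-- Reachability of `s` in exactly `n` steps. -/
def reach (E : Q → Q → Prop) (s : Q) : ℕ → Q → Prop
  | 0, q => q = s
  | n + 1, q => ∃ q', E q q' ∧ reach E s n q'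

lemma lyap [Fintype Q] (P : Q → Q → ℝ) (hP0 : ∀ a b, 0 ≤ P a b)
    (E : Q → Q → Prop) (hE : ∀ a b, E a b → 0 < P a b)
    (hconn : ∀ a b, Relation.ReflTransGen E a b) (s : Q) :
    ∃ h : Q → ℝ, (∀ a, 0 ≤ h a) ∧ ∀ q, q ≠ s → h q + 1 ≤ ∑ x, P q x * h x := by
  have hreach : ∀ q, ∃ n, reach E s n q := by
    intro q
    induction hconn q s using Relation.ReflTransGen.head_induction_on with
    | refl => exact ⟨0, rfl⟩
    | head h _ ih =>
      obtain ⟨n, hn⟩ := ih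
      exact ⟨n + 1, _, h, hn⟩
  obtain ⟨c, hc0, hc1, hc⟩ : ∃ c : ℝ, 0 < c ∧ c < 1 ∧ ∀ a b, E a b → 2 * c ≤ P a b := by
    have h1 : ∀ᶠ c : ℝ in nhdsWithin 0 (Set.Ioi 0), ∀ a b, E a b → 2 * c ≤ P a b := by
      rw [eventually_all]
      intro a
      rw [eventually_all]
      intro b
      by_cases hab : E a b
      · have : ∀ᶠ c : ℝ in nhdsWithin 0 (Set.Ioi 0), c < P a b / 2 :=
          nhdsWithin_le_nhds (eventually_lt_nhds (by have := hE a b hab; linarith))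
        filter_upwards [this] with c hc _
        linarith
      · simp [hab]
    have h2 : ∀ᶠ c : ℝ in nhdsWithin 0 (Set.Ioi 0), c < 1 :=
      nhdsWithin_le_nhds (eventually_lt_nhds one_pos)
    have h3 : ∀ᶠ c : ℝ in nhdsWithin 0 (Set.Ioi 0), 0 < c := eventually_mem_nhdsWithin
    obtain ⟨c, hc⟩ := (h3.and (h2.and h1)).exists
    exact ⟨c, hc.1, hc.2.1, hc.2.2⟩
  set d : Q → ℕ := fun q => Nat.find (hreach q) with hd
  set N := ∑ q, d q with hN
  refine ⟨fun q => c ^ d q / c ^ N, fun a => by positivity, fun q hq => ?_⟩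
  have hcN : 0 < c ^ N := by positivity
  have hge : c ^ N ≤ c ^ d q :=
    pow_le_pow_of_le_one hc0.le hc1.le
      (Finset.single_le_sum (f := d) (fun _ _ => Nat.zero_le _) (Finset.mem_univ q))
  have hspec : reach E s (d q) q := Nat.find_spec (hreach q)
  have key : 2 * c ^ d q ≤ ∑ x, P q x * c ^ d x := by
    rcases hdq : d q with _ | k
    · rw [hdq] at hspec
      exact absurd hspec hq
    · rw [hdq] at hspec
      obtain ⟨q', hE', hr⟩ := hspec
      have hle : d q' ≤ k := Nat.find_min' (hreach q') hr
      calc 2 * c ^ (k + 1) = (2 * c) * c ^ k := by ring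
        _ ≤ P q q' * c ^ d q' := by
          apply mul_le_mul (hc q q' hE') (pow_le_pow_of_le_one hc0.le hc1.le hle)
            (by positivity) (hP0 _ _)
        _ ≤ _ := Finset.single_le_sum (f := fun x => P q x * c ^ d x)
          (fun x _ => mul_nonneg (hP0 _ _) (by positivity)) (Finset.mem_univ q')
  have e : ∑ x, P q x * (c ^ d x / c ^ N) = (∑ x, P q x * c ^ d x) / c ^ N := by
    rw [Finset.sum_div]
    apply Finset.sum_congr rfl
    intro x _
    ring
  simp only
  rw [e, le_div_iff₀ hcN]
  have : (c ^ d q / c ^ N + 1) * c ^ N = c ^ d q + c ^ N := by field_simp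
  linarith

/-! ### Discounted Bellman equation -/

lemma bellman [Fintype Q] (M : MDP Q) (w : Q → Q → ℤ) (l : ℝ) (hl0 : 0 ≤ l) (hl1 : l < 1) :
    ∃ V : Q → ℝ,
      (∀ q ∈ M.Q1, ∀ x, M.E q x → (w q x : ℝ) + l * V x ≤ V q) ∧
      (∀ q ∈ M.Q1, ∃ x, M.E q x ∧ V q = (w q x : ℝ) + l * V x) ∧
      (∀ q, q ∉ M.Q1 → V q = ∑ x, (M.δ q x).toReal * ((w q x : ℝ) + l * V x)) := by
  have hne : ∀ q, (Finset.univ.filter (M.E q)).Nonempty := by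
    intro q
    obtain ⟨x, hx⟩ := M.E_nonempty q
    exact ⟨x, by simpa using hx⟩
  set T : (Q → ℝ) → Q → ℝ := fun V q =>
    if q ∈ M.Q1 then (Finset.univ.filter (M.E q)).sup' (hne q) (fun x => (w q x : ℝ) + l * V x)
    else ∑ x, (M.δ q x).toReal * ((w q x : ℝ) + l * V x) with hT
  have hmono : ∀ V U : Q → ℝ, ∀ q, T V q ≤ T U q + l * dist V U := by
    intro V U q
    have hVU : ∀ x, (w q x : ℝ) + l * V x ≤ (w q x : ℝ) + l * U x + l * dist V U := by
      intro x
      have h1 : V x - U x ≤ dist V U :=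
        (le_abs_self _).trans ((Real.dist_eq _ _).symm.le.trans (dist_le_pi_dist V U x))
      have := mul_le_mul_of_nonneg_left h1 hl0
      linarith
    simp only [hT]
    split_ifs with hq
    · apply Finset.sup'_le
      intro x hx
      refine (hVU x).trans ?_
      gcongr
      exact Finset.le_sup' (fun x => (w q x : ℝ) + l * U x) hx
    · calc ∑ x, (M.δ q x).toReal * ((w q x : ℝ) + l * V x)
          ≤ ∑ x, (M.δ q x).toReal * ((w q x : ℝ) + l * U x + l * dist V U) :=
            Finset.sum_le_sum (fun x _ => mul_le_mul_of_nonneg_left (hVU x) ENNReal.toReal_nonneg)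
        _ = _ := by
          simp_rw [mul_add _ _ (l * dist V U)]
          rw [Finset.sum_add_distrib, ← Finset.sum_mul, pmf_sum_toReal, one_mul]
  have hcontr : ContractingWith ⟨l, hl0⟩ T := by
    refine ⟨by exact_mod_cast hl1, LipschitzWith.of_dist_le_mul fun V U => ?_⟩
    rw [dist_pi_le_iff (by positivity)]
    intro q
    rw [Real.dist_eq, abs_le]
    have h1 := hmono V U q
    have h2 := hmono U V q
    rw [dist_comm U V] at h2
    constructor
    · change -(l * dist V U) ≤ _
      linarith
    · change _ ≤ l * dist V U
      linarith
  set V := hcontr.fixedPoint T with hV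
  have hfix : T V = V := hcontr.fixedPoint_isFixedPt
  refine ⟨V, ?_, ?_, ?_⟩
  · intro q hq x hx
    have := congrFun hfix q
    simp only [hT, hq, if_true] at this
    rw [← this]
    exact Finset.le_sup' (fun x => (w q x : ℝ) + l * V x) (by simpa using hx)
  · intro q hq
    have := congrFun hfix q
    simp only [hT, hq, if_true] at this
    obtain ⟨x, hx, he⟩ := Finset.exists_mem_eq_sup' (hne q) (fun x => (w q x : ℝ) + l * V x)
    exact ⟨x, by simpa using hx, by rw [← this, he]⟩
  · intro q hq
    have := congrFun hfix q
    simp only [hT, hq, if_false] at this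
    exact this.symm

lemma bellman_sub [Fintype Q] {M : MDP Q} {w : Q → Q → ℤ} {l : ℝ} {V : Q → ℝ}
    (h1 : ∀ q ∈ M.Q1, ∀ x, M.E q x → (w q x : ℝ) + l * V x ≤ V q)
    (h3 : ∀ q, q ∉ M.Q1 → V q = ∑ x, (M.δ q x).toReal * ((w q x : ℝ) + l * V x))
    (σ : Strategy M) (h : List Q) (q : Q) :
    ∑ x, (M.step σ h q x).toReal * ((w q x : ℝ) + l * V x) ≤ V q := by
  by_cases hq : q ∈ M.Q1
  · calc ∑ x, (M.step σ h q x).toReal * ((w q x : ℝ) + l * V x)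
        ≤ ∑ x, (M.step σ h q x).toReal * V q := by
          apply Finset.sum_le_sum
          intro x _
          by_cases hx : M.E q x
          · exact mul_le_mul_of_nonneg_left (h1 q hq x hx) ENNReal.toReal_nonneg
          · have : M.step σ h q x = 0 := by
              by_contra hne
              apply hx
              have : x ∈ (M.step σ h q).support := (PMF.mem_support_iff _ _).2 hne
              simp only [MDP.step, hq, if_true] at this
              exact σ.act_support h q hq x this
            simp [this]
      _ = V q := by rw [← Finset.sum_mul, pmf_sum_toReal, one_mul]
  · simp only [MDP.step, hq, if_false]
    exact (h3 q hq).ge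

/-! ### Mixed memoryless strategies -/

lemma mixPMF [Fintype Q] (A B : PMF Q) (ε : ℝ) (h0 : 0 ≤ ε) (h1 : ε ≤ 1) :
    ∃ P : PMF Q, ∀ x, (P x).toReal = (1 - ε) * (A x).toReal + ε * (B x).toReal := by
  have hnn : ∀ x, 0 ≤ (1 - ε) * (A x).toReal + ε * (B x).toReal := fun x =>
    add_nonneg (mul_nonneg (by linarith) ENNReal.toReal_nonneg)
      (mul_nonneg h0 ENNReal.toReal_nonneg)
  refine ⟨PMF.ofFintype
    (fun x => ENNReal.ofReal ((1 - ε) * (A x).toReal + ε * (B x).toReal)) ?_, fun x => ?_⟩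
  · rw [← ENNReal.ofReal_sum_of_nonneg (fun x _ => hnn x), Finset.sum_add_distrib,
      ← Finset.mul_sum, ← Finset.mul_sum, pmf_sum_toReal, pmf_sum_toReal]
    simp
  · rw [PMF.ofFintype_apply, ENNReal.toReal_ofReal (hnn x)]

lemma exists_strat [Fintype Q] (M : MDP Q) (g : Q → Q) (hg : ∀ q, M.E q (g q)) (ε : ℝ)
    (h0 : 0 < ε) (h1 : ε ≤ 1) :
    ∃ (σ : Strategy M) (U : Q → PMF Q),
      (∀ h q, M.step σ h q = M.step σ [] q) ∧
      (∀ q x, M.E q x → 0 < (M.step σ [] q x).toReal) ∧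
      ∀ q ∈ M.Q1, ∀ F : Q → ℝ, ∑ x, (M.step σ [] q x).toReal * F x =
        (1 - ε) * F (g q) + ε * ∑ x, (U q x).toReal * F x := by
  have hne : ∀ q, (Finset.univ.filter (M.E q)).Nonempty := fun q => ⟨g q, by simpa using hg q⟩
  set U : Q → PMF Q := fun q => PMF.uniformOfFinset (Finset.univ.filter (M.E q)) (hne q) with hU
  have hUs : ∀ q x, U q x ≠ 0 ↔ M.E q x := by
    intro q x
    have : x ∈ (U q).support ↔ x ∈ Finset.univ.filter (M.E q) :=
      PMF.mem_support_uniformOfFinset_iff _ _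
    rw [PMF.mem_support_iff] at this
    simpa using this
  choose P hP using fun q => mixPMF (PMF.pure (g q)) (U q) ε h0.le h1
  refine ⟨⟨fun _ q => P q, ?_⟩, U, ?_, ?_, ?_⟩
  · intro _ q _ x hx
    by_contra hE
    rw [PMF.mem_support_iff] at hx
    have hu : U q x = 0 := by
      by_contra h
      exact hE ((hUs q x).1 h)
    have hxg : x ≠ g q := by
      rintro rfl
      exact hE (hg q)
    have := hP q x
    rw [hu, PMF.pure_apply, if_neg hxg] at this
    simp only [ENNReal.toReal_zero, mul_zero, add_zero] at this
    rw [ENNReal.toReal_eq_zero_iff] at this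
    rcases this with h | h
    · exact hx h
    · exact PMF.apply_ne_top _ _ h
  · intro h q
    simp [MDP.step]
  · intro q x hx
    by_cases hq : q ∈ M.Q1
    · simp only [MDP.step, hq, if_true]
      rw [hP]
      have : 0 < (U q x).toReal := ENNReal.toReal_pos ((hUs q x).2 hx) (PMF.apply_ne_top _ _)
      have h3 : 0 ≤ (1 - ε) * ((PMF.pure (g q)) x).toReal :=
        mul_nonneg (by linarith) ENNReal.toReal_nonneg
      have := mul_pos h0 this
      linarith
    · simp only [MDP.step, hq, if_false]
      exact ENNReal.toReal_pos ((PMF.mem_support_iff _ _).1 ((M.δ_support q hq x).2 hx))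
        (PMF.apply_ne_top _ _)
  · intro q hq F
    simp only [MDP.step, hq, if_true]
    simp_rw [hP, add_mul, mul_assoc]
    rw [Finset.sum_add_distrib, ← Finset.mul_sum, ← Finset.mul_sum]
    congr 2
    rw [Finset.sum_eq_single (g q)]
    · simp
    · intro b _ hb
      simp [PMF.pure_apply, hb]
    · simp

/-! ### Main argument -/

section main
variable [Fintype Q] [MeasurableSpace Q] [MeasurableSingletonClass Q]

lemma measurable_MP (w : Q → Q → ℤ) : Measurable (MP w) := by
  unfold MP
  apply Measurable.liminf
  intro n
  apply Measurable.div_const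
  unfold EL
  push_cast
  apply Finset.measurable_fun_sum
  intro i _
  exact measurable_pair (fun a b => (w a b : ℝ)) i (i + 1)

/-- The discounted value bounds the expected mean payoff of every strategy. -/
lemma integral_MP_le {M : MDP Q} {w : Q → Q → ℤ} {l : ℝ} {V : Q → ℝ} (hl1 : l < 1)
    (h1 : ∀ q ∈ M.Q1, ∀ x, M.E q x → (w q x : ℝ) + l * V x ≤ V q)
    (h3 : ∀ q, q ∉ M.Q1 → V q = ∑ x, (M.δ q x).toReal * ((w q x : ℝ) + l * V x))
    {m : ℝ} (hm : ∀ q, V q ≤ m)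
    {σ : Strategy M} {q : Q} {μ : Measure (ℕ → Q)} (hμ : IsTrajMeasure M σ q μ) :
    ∫ ρ, MP w ρ ∂μ ≤ (1 - l) * m := by
  have := hμ.1
  obtain ⟨W, hW0, hW⟩ := exists_abs_bound (fun a b => (w a b : ℝ))
  obtain ⟨B, hB0, hB⟩ := exists_abs_bound1 (fun a => l * V a)
  apply le_of_forall_pos_le_add
  intro η hη
  set c := (1 - l) * m + η with hc
  have hdrift : ∀ h q, η ≤ ∑ x, (M.step σ h q x).toReal *
      (-((w q x : ℝ) + l * V x - l * V q - c)) := by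
    intro h q
    have hs := bellman_sub h1 h3 σ h q
    have e : ∑ x, (M.step σ h q x).toReal * (-((w q x : ℝ) + l * V x - l * V q - c)) =
        (l * V q + c) - ∑ x, (M.step σ h q x).toReal * ((w q x : ℝ) + l * V x) := by
      have : ∀ x, (M.step σ h q x).toReal * (-((w q x : ℝ) + l * V x - l * V q - c)) =
        (M.step σ h q x).toReal * (l * V q + c) -
          (M.step σ h q x).toReal * ((w q x : ℝ) + l * V x) := fun x => by ring
      simp_rw [this]
      rw [Finset.sum_sub_distrib, ← Finset.sum_mul, pmf_sum_toReal, one_mul]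
    rw [e]
    have := mul_le_mul_of_nonneg_left (hm q) (by linarith : 0 ≤ 1 - l)
    linarith
  have hae := eventually_pos hμ (fun q x => -((w q x : ℝ) + l * V x - l * V q - c)) η hη hdrift
  have hle : ∀ᵐ ρ ∂μ, MP w ρ ≤ c := by
    filter_upwards [hae] with ρ hρ
    apply MP_le hW ρ c (2 * B)
    filter_upwards [hρ] with n hn
    rw [Finset.sum_neg_distrib, sum_tele w (fun a => l * V a) c ρ n] at hn
    have b1 := (abs_le.1 (hB (ρ n))).1
    have b2 := (abs_le.1 (hB (ρ 0))).2
    linarith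
  have hint : Integrable (MP w) μ :=
    Integrable.of_bound (measurable_MP w).aestronglyMeasurable W
      (Eventually.of_forall fun ρ => by rw [Real.norm_eq_abs]; exact MP_bound hW ρ)
  calc ∫ ρ, MP w ρ ∂μ ≤ ∫ _, c ∂μ := integral_mono_ae hint (integrable_const c) hle
    _ = c := by simp

/-- Span bound for the discounted value function. -/
lemma span_bound {M : MDP Q} {w : Q → Q → ℤ} {l : ℝ} {V : Q → ℝ} (hl0 : 0 ≤ l) (hl1 : l < 1)
    (h1 : ∀ q ∈ M.Q1, ∀ x, M.E q x → (w q x : ℝ) + l * V x ≤ V q)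
    (h2 : ∀ q ∈ M.Q1, ∃ x, M.E q x ∧ V q = (w q x : ℝ) + l * V x)
    (h3 : ∀ q, q ∉ M.Q1 → V q = ∑ x, (M.δ q x).toReal * ((w q x : ℝ) + l * V x))
    {W : ℝ} (hW : ∀ a b, |(w a b : ℝ)| ≤ W)
    {s : Q} (hs : ∀ q, V q ≤ V s) (σ : Strategy M) (k : Q → ℝ) (hk0 : ∀ q, 0 ≤ k q)
    (hk : ∀ q, q ≠ s → k q + 1 ≤ ∑ x, (M.step σ [] q x).toReal * k x) (q : Q) :
    V s - V q ≤ (2 * W + 1) * k s := by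
  have hW0 : 0 ≤ W := (abs_nonneg _).trans (hW s s)
  have hVs : (1 - l) * V s ≤ W := by
    have hx : ∀ x, (w s x : ℝ) + l * V x ≤ W + l * V s := fun x =>
      add_le_add (abs_le.1 (hW s x)).2 (mul_le_mul_of_nonneg_left (hs x) hl0)
    have : V s ≤ W + l * V s := by
      by_cases hq : s ∈ M.Q1
      · obtain ⟨x, _, he⟩ := h2 s hq
        rw [he]
        have := hx x
        rw [he] at this
        exact this
      · calc V s = ∑ x, (M.δ s x).toReal * ((w s x : ℝ) + l * V x) := h3 s hq
          _ ≤ ∑ x, (M.δ s x).toReal * (W + l * V s) :=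
            Finset.sum_le_sum (fun x _ => mul_le_mul_of_nonneg_left (hx x) ENNReal.toReal_nonneg)
          _ = _ := by rw [← Finset.sum_mul, pmf_sum_toReal, one_mul]
    linarith
  have : Nonempty Q := ⟨s⟩
  obtain ⟨t, ht⟩ := Finite.exists_max (fun q => (V s - V q) + (2 * W + 1) * k q)
  have hkey : t = s := by
    by_contra hts
    set P := fun x => (M.step σ [] t x).toReal with hP
    have hP0 : ∀ x, 0 ≤ P x := fun x => ENNReal.toReal_nonneg
    have hP1 : ∑ x, P x = 1 := pmf_sum_toReal _
    have a1 : ∑ x, P x * ((V s - V x) + (2 * W + 1) * k x) ≤ (V s - V t) + (2 * W + 1) * k t := by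
      calc _ ≤ ∑ x, P x * ((V s - V t) + (2 * W + 1) * k t) :=
            Finset.sum_le_sum (fun x _ => mul_le_mul_of_nonneg_left (ht x) (hP0 x))
        _ = _ := by rw [← Finset.sum_mul, hP1, one_mul]
    have a2 : ∑ x, P x * ((V s - V x) + (2 * W + 1) * k x) =
        V s - ∑ x, P x * V x + (2 * W + 1) * ∑ x, P x * k x := by
      have : ∀ x, P x * ((V s - V x) + (2 * W + 1) * k x) =
        P x * V s - P x * V x + (2 * W + 1) * (P x * k x) := fun x => by ring
      simp_rw [this]
      rw [Finset.sum_add_distrib, Finset.sum_sub_distrib, ← Finset.sum_mul, hP1, one_mul,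
        Finset.mul_sum]
    have a3 : k t + 1 ≤ ∑ x, P x * k x := hk t hts
    have a4 : ∑ x, P x * ((w t x : ℝ) + l * V x) ≤ V t := bellman_sub h1 h3 σ [] t
    have a5 : ∑ x, P x * V x - 2 * W ≤ ∑ x, P x * ((w t x : ℝ) + l * V x) := by
      calc ∑ x, P x * V x - 2 * W = ∑ x, P x * (V x - 2 * W) := by
            simp_rw [mul_sub]
            rw [Finset.sum_sub_distrib, ← Finset.sum_mul, hP1, one_mul]
        _ ≤ _ := by
            apply Finset.sum_le_sum
            intro x _
            apply mul_le_mul_of_nonneg_left _ (hP0 x)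
            have b1 := (abs_le.1 (hW t x)).1
            have b2 := mul_le_mul_of_nonneg_left (hs x) (by linarith : 0 ≤ 1 - l)
            linarith
    have a6 := mul_le_mul_of_nonneg_left a3 (by linarith : 0 ≤ 2 * W + 1)
    linarith
  have := ht q
  rw [hkey] at this
  have h4 : 0 ≤ (2 * W + 1) * k q := mul_nonneg (by linarith) (hk0 q)
  linarith

/-- Under a memoryless strategy giving every edge positive probability in a strongly connected
MDP, every state is visited infinitely often, almost surely. -/
lemma visit_all {M : MDP Q} {σ : Strategy M} (hmem : ∀ h q, M.step σ h q = M.step σ [] q)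
    (hfull : ∀ q x, M.E q x → 0 < (M.step σ [] q x).toReal)
    (hconn : ∀ a b, Relation.ReflTransGen M.E a b)
    {q : Q} {μ : Measure (ℕ → Q)} (hμ : IsTrajMeasure M σ q μ) :
    ∀ᵐ ρ ∂μ, infSet ρ = Set.univ := by
  have key : ∀ s : Q, ∀ᵐ ρ ∂μ, s ∈ infSet ρ := by
    intro s
    obtain ⟨k, hk0, hk⟩ := lyap (fun a b => (M.step σ [] a b).toReal)
      (fun _ _ => ENNReal.toReal_nonneg) M.E hfull hconn s
    obtain ⟨B, hB0, hB⟩ := exists_abs_bound1 k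
    set K : Q → ℝ := fun q => if q = s then k s + 1 else 0 with hK
    have hdrift : ∀ h q, (1 / 2 : ℝ) ≤ ∑ x, (M.step σ h q x).toReal *
        (K q + k x - k q - 1 / 2) := by
      intro h q
      rw [hmem h q]
      have e : ∑ x, (M.step σ [] q x).toReal * (K q + k x - k q - 1 / 2) =
          (K q - k q - 1 / 2) + ∑ x, (M.step σ [] q x).toReal * k x := by
        have : ∀ x, (M.step σ [] q x).toReal * (K q + k x - k q - 1 / 2) =
          (M.step σ [] q x).toReal * (K q - k q - 1 / 2) + (M.step σ [] q x).toReal * k x :=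
          fun x => by ring
        simp_rw [this]
        rw [Finset.sum_add_distrib, ← Finset.sum_mul, pmf_sum_toReal, one_mul]
      rw [e]
      by_cases hq : q = s
      · subst hq
        have : 0 ≤ ∑ x, (M.step σ [] q x).toReal * k x :=
          Finset.sum_nonneg (fun x _ => mul_nonneg ENNReal.toReal_nonneg (hk0 x))
        simp only [hK, if_true]
        linarith
      · have := hk q hq
        simp only [hK, if_neg hq]
        linarith
    filter_upwards [eventually_pos hμ (fun q x => K q + k x - k q - 1 / 2) (1 / 2) (by norm_num)
      hdrift] with ρ hρ
    by_contra hcon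
    have hcon' : ∃ N, ∀ n, N ≤ n → ρ n ≠ s := by
      by_contra h
      push Not at h
      exact hcon h
    obtain ⟨N, hN⟩ := hcon'
    have tele : ∀ n, ∑ i ∈ Finset.range n, (K (ρ i) + k (ρ (i + 1)) - k (ρ i) - 1 / 2) =
        ∑ i ∈ Finset.range n, K (ρ i) + k (ρ n) - k (ρ 0) - n / 2 := by
      intro n
      induction n with
      | zero => simp
      | succ n ih =>
        rw [Finset.sum_range_succ, ih, Finset.sum_range_succ]
        push_cast
        ring
    have hKs : ∀ n, N ≤ n → ∑ i ∈ Finset.range n, K (ρ i) = ∑ i ∈ Finset.range N, K (ρ i) := by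
      intro n hn
      induction n, hn using Nat.le_induction with
      | base => rfl
      | succ n hn ih =>
        rw [Finset.sum_range_succ, ih]
        simp [hK, hN n hn]
    obtain ⟨n0, hn0⟩ := exists_nat_ge (2 * (∑ i ∈ Finset.range N, K (ρ i) + 2 * B))
    obtain ⟨n, hn⟩ := (hρ.and ((eventually_ge_atTop N).and (eventually_ge_atTop n0))).exists
    obtain ⟨p1, p2, p3⟩ := hn
    rw [tele, hKs n p2] at p1
    have b1 := (abs_le.1 (hB (ρ n))).2
    have b2 := (abs_le.1 (hB (ρ 0))).1
    have : (n0 : ℝ) ≤ n := by exact_mod_cast p3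
    linarith
  filter_upwards [ae_all_iff.2 key] with ρ hρ
  exact Set.eq_univ_of_forall hρ

end main

/-- Key lemma (strict version): in an MDP whose whole state space is an
end-component with even minimal priority, if some state has expected mean-payoff
value greater than `ν`, then some strategy wins the mean-payoff parity objective
`Parity(p) ∩ MeanPayoff^{>ν}` almost surely from every state. -/
theorem key_lemma_gt [Fintype Q] [Nonempty Q]
    [MeasurableSpace Q] [MeasurableSingletonClass Q]
    (M : MDP Q) (p : Q → ℕ) (w : Q → Q → ℤ) (ν : ℝ)
    (hEC : M.IsEndComponent Set.univ)
    (hmin : Even (sInf (Set.range p)))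
    (hval : ∃ q : Q, ν < ValMP M w q) :
    ∃ σstar : Strategy M, ∀ q : Q, ∃ μ : Measure (ℕ → Q),
      IsTrajMeasure M σstar q μ ∧ μ (ParitySet p ∩ MeanPayoffGt w ν) = 1 := by
  have hconn : ∀ a b, Relation.ReflTransGen M.E a b := by
    intro a b
    exact Relation.ReflTransGen.mono (fun _ _ h => h.2.2) _ _
      (hEC.2.2.2 a (Set.mem_univ _) b (Set.mem_univ _))
  choose g0 hg0 using M.E_nonempty
  obtain ⟨σu, Uu, hmemu, hfullu, -⟩ := exists_strat M g0 hg0 1 one_pos le_rfl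
  -- a strategy with expected mean payoff above the threshold
  obtain ⟨q0, hq0⟩ := hval
  obtain ⟨a, ⟨σ0, μ0, hμ0, rfl⟩, ha⟩ := exists_lt_of_lt_csSup (by
    obtain ⟨μ, hμ⟩ := exists_traj M σu q0
    exact ⟨_, σu, μ, hμ, rfl⟩) hq0
  set a := ∫ ρ, MP w ρ ∂μ0 with hadef
  obtain ⟨W, hW0, hW⟩ := exists_abs_bound (fun a b => (w a b : ℝ))
  choose k hk0 hk using fun s => lyap (fun a b => (M.step σu [] a b).toReal)
      (fun _ _ => ENNReal.toReal_nonneg) M.E hfullu hconn s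
  set C := (2 * W + 1) * ∑ s, k s s with hC
  have hC0 : 0 ≤ C := mul_nonneg (by linarith) (Finset.sum_nonneg (fun s _ => hk0 s s))
  obtain ⟨ν2, hν2, hν2a⟩ := exists_between ha
  obtain ⟨ν1, hν1, hν12⟩ := exists_between hν2
  obtain ⟨ν', hν', hν'1⟩ := exists_between hν1
  set κ := min 1 ((a - ν2) / (C + 1)) with hκ
  have hκ0 : 0 < κ := lt_min one_pos (div_pos (by linarith) (by linarith))
  have hκ1 : κ ≤ 1 := min_le_left _ _
  have hκC : κ * (C + 1) ≤ a - ν2 := by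
    rw [← le_div_iff₀ (by linarith)]
    exact min_le_right _ _
  set l := 1 - κ with hl
  have hl0 : 0 ≤ l := by linarith
  have hl1 : l < 1 := by linarith
  obtain ⟨V, h1, h2, h3⟩ := bellman M w l hl0 hl1
  obtain ⟨s, hs⟩ := Finite.exists_max V
  have hup : a ≤ (1 - l) * V s := integral_MP_le hl1 h1 h3 hs hμ0
  have hlow : ∀ q, ν2 ≤ (1 - l) * V q := by
    intro q
    have hsp := span_bound hl0 hl1 h1 h2 h3 hW hs σu (k s) (hk0 s) (hk s) q
    have hks : (2 * W + 1) * k s s ≤ C :=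
      mul_le_mul_of_nonneg_left (Finset.single_le_sum (f := fun s => k s s)
        (fun s _ => hk0 s s) (Finset.mem_univ s)) (by linarith)
    have hlk : 1 - l = κ := by rw [hl]; ring
    rw [hlk] at hup ⊢
    have := mul_le_mul_of_nonneg_left (hsp.trans hks) hκ0.le
    linarith
  -- the greedy selector
  have hg : ∀ q, ∃ x, M.E q x ∧ (q ∈ M.Q1 → V q = (w q x : ℝ) + l * V x) := by
    intro q
    by_cases hq : q ∈ M.Q1
    · obtain ⟨x, hx, he⟩ := h2 q hq
      exact ⟨x, hx, fun _ => he⟩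
    · exact ⟨g0 q, hg0 q, fun h => absurd h hq⟩
  choose g hgE hgV using hg
  set F : Q → Q → ℝ := fun q x => (w q x : ℝ) + l * V x - l * V q with hF
  obtain ⟨B, hB0, hB⟩ := exists_abs_bound F
  set ε := min 1 ((ν2 - ν1) / (|ν2| + B + 1)) with hε
  have hden : 0 < |ν2| + B + 1 := by positivity
  have hε0 : 0 < ε := lt_min one_pos (div_pos (by linarith) hden)
  have hε1 : ε ≤ 1 := min_le_left _ _
  have hεB : ε * (|ν2| + B + 1) ≤ ν2 - ν1 := by
    rw [← le_div_iff₀ hden]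
    exact min_le_right _ _
  obtain ⟨σ, U, hmem, hfull, hexp⟩ := exists_strat M g hgE ε hε0 hε1
  have hdrift : ∀ h q, ν1 - ν' ≤ ∑ x, (M.step σ h q x).toReal *
      ((w q x : ℝ) + l * V x - l * V q - ν') := by
    intro h q
    rw [hmem h q]
    have e : ∑ x, (M.step σ [] q x).toReal * ((w q x : ℝ) + l * V x - l * V q - ν') =
        ∑ x, (M.step σ [] q x).toReal * F q x - ν' := by
      simp_rw [mul_sub _ _ ν']
      rw [Finset.sum_sub_distrib, ← Finset.sum_mul, pmf_sum_toReal, one_mul]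
    rw [e]
    suffices ν1 ≤ ∑ x, (M.step σ [] q x).toReal * F q x by linarith
    by_cases hq : q ∈ M.Q1
    · rw [hexp q hq (F q)]
      have f1 : ν2 ≤ F q (g q) := by
        have := hlow q
        simp only [hF]
        rw [← hgV q hq]
        linarith
      have f2 : -B ≤ ∑ x, (U q x).toReal * F q x := by
        calc -B = ∑ x, (U q x).toReal * (-B) := by
              rw [← Finset.sum_mul, pmf_sum_toReal, one_mul]
          _ ≤ _ := Finset.sum_le_sum (fun x _ => mul_le_mul_of_nonneg_left
              (abs_le.1 (hB q x)).1 ENNReal.toReal_nonneg)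
      have f3 := mul_le_mul_of_nonneg_left f1 (by linarith : 0 ≤ 1 - ε)
      have f4 := mul_le_mul_of_nonneg_left f2 hε0.le
      have f5 := mul_le_mul_of_nonneg_left (le_abs_self ν2) hε0.le
      linarith
    · have : ∑ x, (M.step σ [] q x).toReal * F q x = (1 - l) * V q := by
        have e3 := h3 q hq
        simp only [MDP.step, hq, if_false]
        simp only [hF]
        simp_rw [mul_sub _ _ (l * V q)]
        rw [Finset.sum_sub_distrib, ← Finset.sum_mul, pmf_sum_toReal, one_mul, ← e3]
        ring
      rw [this]
      exact hν12.le.trans (hlow q)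
  obtain ⟨B', hB'0, hB'⟩ := exists_abs_bound1 (fun a => l * V a)
  refine ⟨σ, fun q => ?_⟩
  obtain ⟨μ, hμ⟩ := exists_traj M σ q
  refine ⟨μ, hμ, ?_⟩
  have := hμ.1
  have hae : ∀ᵐ ρ ∂μ, ρ ∈ ParitySet p ∩ MeanPayoffGt w ν := by
    filter_upwards [visit_all hmem hfull hconn hμ,
      eventually_pos hμ (fun q x => (w q x : ℝ) + l * V x - l * V q - ν') (ν1 - ν')
        (by linarith) hdrift] with ρ hρ1 hρ2
    constructor
    · change Even (sInf (p '' infSet ρ))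
      rw [hρ1, Set.image_univ]
      exact hmin
    · change ν < MP w ρ
      refine hν'.trans_le (le_MP hW ρ ν' (-(2 * B')) ?_)
      filter_upwards [hρ2] with n hn
      rw [sum_tele w (fun a => l * V a) ν' ρ n] at hn
      have b1 := (abs_le.1 (hB' (ρ n))).2
      have b2 := (abs_le.1 (hB' (ρ 0))).1
      linarith
  have heq : (ParitySet p ∩ MeanPayoffGt w ν : Set (ℕ → Q)) =ᵐ[μ] Set.univ :=
    eventuallyEq_univ.2 hae
  rw [measure_congr heq, measure_univ]

end MPP
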